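/- Uniform-in-time stability of dG(0) and dG(1) with vanishing initial data (inequality (4.10) of the paper). Let q ∈ {0,1} and l ∈ ℝ. There is a constant C > 0, independent of T, N and the mesh, such that if U = (U₁,U₂) ∈ 𝒱_q satisfies B(U,V) = Σ_{n=1}^N ∫_{I_n} ( a(f₁,V₁) + (f₂,V₂) ) dt for all V ∈ 𝒱_q (i.e., the generalized dG problem with u₀ = 0, v₀ = 0), and U₁(t) ∈ Ḣ^{l+1}, U₂(t) ∈ Ḣ^{l} for all t, then sup_{t∈(0,T)} ‖U₁(t)‖_{l+1} + sup_{t∈(0,T)} ‖U₂(t)‖_{l} ≤ C ∫₀^T ( ‖f₁(t)‖_{l+1} + ‖f₂(t)‖_{l} ) dt. -/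

import Mathlib

noncomputable section

open scoped RealInnerProductSpace BigOperators
open MeasureTheory

/-- Squared fractional-order norm `‖v‖_α² = Σ_k λ_k^α (v,φ_k)²`. -/
def hsNormSq {H : Type*} [NormedAddCommGroup H] [InnerProductSpace ℝ H]
    (φ : ℕ → H) (lam : ℕ → ℝ) (α : ℝ) (v : H) : ℝ :=
  ∑' k, lam k ^ α * ⟪v, φ k⟫ ^ 2

/-- Fractional-order norm `‖v‖_α`. -/
def hsNorm {H : Type*} [NormedAddCommGroup H] [InnerProductSpace ℝ H]
    (φ : ℕ → H) (lam : ℕ → ℝ) (α : ℝ) (v : H) : ℝ :=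
  Real.sqrt (hsNormSq φ lam α v)

/-- Membership in the fractional-order space `Ḣ^α`. -/
def MemHs {H : Type*} [NormedAddCommGroup H] [InnerProductSpace ℝ H]
    (φ : ℕ → H) (lam : ℕ → ℝ) (α : ℝ) (v : H) : Prop :=
  Summable (fun k => lam k ^ α * ⟪v, φ k⟫ ^ 2)

/-- Weighted spectral pairing `Σ_k λ_k^l (u,φ_k)(v,φ_k)`.
`aPow φ lam 1 u v = a(u,v)`, `aPow φ lam (l+1) u v = a(u, A^l v)` and
`aPow φ lam l u v = (u, A^l v)`. -/
def aPow {H : Type*} [NormedAddCommGroup H] [InnerProductSpace ℝ H]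
    (φ : ℕ → H) (lam : ℕ → ℝ) (l : ℝ) (u v : H) : ℝ :=
  ∑' k, lam k ^ l * ⟪u, φ k⟫ * ⟪v, φ k⟫

/-- The energy bilinear form `a(u,v) = Σ_k λ_k (u,φ_k)(v,φ_k)`. -/
def aForm {H : Type*} [NormedAddCommGroup H] [InnerProductSpace ℝ H]
    (φ : ℕ → H) (lam : ℕ → ℝ) (u v : H) : ℝ :=
  aPow φ lam 1 u v

/-- The operator `A`, determined by `A φ_k = λ_k φ_k`. -/
def Aop {H : Type*} [NormedAddCommGroup H] [InnerProductSpace ℝ H]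
    (φ : ℕ → H) (lam : ℕ → ℝ) (v : H) : H :=
  ∑' k, (lam k * ⟪v, φ k⟫) • φ k

/-- Value at time `s` of the polynomial of degree ≤ q (with coefficients `c n ·`)
attached to the `n`-th time subinterval. -/
def pval {H : Type*} [NormedAddCommGroup H] [InnerProductSpace ℝ H]
    (q : ℕ) (c : ℕ → ℕ → H) (n : ℕ) (s : ℝ) : H :=
  ∑ j ∈ Finset.range (q + 1), s ^ j • c n j

/-- Time derivative of `pval`. -/
def pderiv {H : Type*} [NormedAddCommGroup H] [InnerProductSpace ℝ H]
    (q : ℕ) (c : ℕ → ℕ → H) (n : ℕ) (s : ℝ) : H :=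
  ∑ j ∈ Finset.range (q + 1), ((j : ℝ) * s ^ (j - 1)) • c n j

/-- The dG bilinear form `B((u₁,u₂),(v₁,v₂))`, where the piecewise polynomials
`u₁, u₂, v₁, v₂` are described by their coefficient families `c1, c2, d1, d2`
(on the mesh `0 = tt 0 < tt 1 < ⋯ < tt N`). -/
def Bform {H : Type*} [NormedAddCommGroup H] [InnerProductSpace ℝ H]
    (φ : ℕ → H) (lam : ℕ → ℝ) (tt : ℕ → ℝ) (N q : ℕ)
    (c1 c2 d1 d2 : ℕ → ℕ → H) : ℝ :=
  (∑ n ∈ Finset.Icc 1 N, ∫ s in tt (n-1)..tt n,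
      (aForm φ lam (pderiv q c1 n s) (pval q d1 n s)
        - aForm φ lam (pval q c2 n s) (pval q d1 n s)
        + ⟪pderiv q c2 n s, pval q d2 n s⟫
        + aForm φ lam (pval q c1 n s) (pval q d2 n s)))
  + (∑ n ∈ Finset.Icc 1 (N-1),
      (aForm φ lam (pval q c1 (n+1) (tt n) - pval q c1 n (tt n)) (pval q d1 (n+1) (tt n))
        + ⟪pval q c2 (n+1) (tt n) - pval q c2 n (tt n), pval q d2 (n+1) (tt n)⟫))
  + aForm φ lam (pval q c1 1 (tt 0)) (pval q d1 1 (tt 0))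
  + ⟪pval q c2 1 (tt 0), pval q d2 1 (tt 0)⟫

/-- Supremum of `g` over the open interval `(a,b)`. -/
def supIoo (g : ℝ → ℝ) (a b : ℝ) : ℝ :=
  sSup (g '' Set.Ioo a b)

/-- Squared discrete fractional norm `‖v‖_{h,s}² = ‖A_h^{s/2} v‖²`, expressed through
an orthonormal eigenbasis `e` of `A_h` on `S_h` with eigenvalues `μ`. -/
def hNormSqh {H : Type*} [NormedAddCommGroup H] [InnerProductSpace ℝ H]
    {m : ℕ} (e : Fin m → H) (μ : Fin m → ℝ) (s : ℝ) (v : H) : ℝ :=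
  ∑ i, μ i ^ s * ⟪v, e i⟫ ^ 2

/-- Discrete fractional norm `‖v‖_{h,s}`. -/
def hNormh {H : Type*} [NormedAddCommGroup H] [InnerProductSpace ℝ H]
    {m : ℕ} (e : Fin m → H) (μ : Fin m → ℝ) (s : ℝ) (v : H) : ℝ :=
  Real.sqrt (hNormSqh e μ s v)

/-- Discrete weighted pairing: `aPowh e μ (l+1) u v = a(u, A_h^l v)` and
`aPowh e μ l u v = (u, A_h^l v)` for `u, v ∈ S_h`. -/
def aPowh {H : Type*} [NormedAddCommGroup H] [InnerProductSpace ℝ H]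
    {m : ℕ} (e : Fin m → H) (μ : Fin m → ℝ) (l : ℝ) (u v : H) : ℝ :=
  ∑ i, μ i ^ l * ⟪u, e i⟫ * ⟪v, e i⟫

/-- A vector with a single nonzero spectral coefficient lies in every `Ḣ^α`. -/
theorem memHs_smul_basis {H : Type*} [NormedAddCommGroup H] [InnerProductSpace ℝ H]
    {φ : ℕ → H} (hφ : Orthonormal ℝ φ) (lam : ℕ → ℝ) (α x : ℝ) (k : ℕ) :
    MemHs φ lam α (x • φ k) := by
  apply summable_of_ne_finset_zero (s := {k})
  intro b hb
  have hkb : k ≠ b := fun h => hb (by simp [h])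
  simp [inner_smul_left, hφ.2 hkb]

theorem memHs_zero {H : Type*} [NormedAddCommGroup H] [InnerProductSpace ℝ H]
    (φ : ℕ → H) (lam : ℕ → ℝ) (α : ℝ) : MemHs φ lam α 0 := by
  simp [MemHs]

theorem aForm_smul_basis {H : Type*} [NormedAddCommGroup H] [InnerProductSpace ℝ H]
    {φ : ℕ → H} (hφ : Orthonormal ℝ φ) (lam : ℕ → ℝ) (u : H) (x : ℝ) (k : ℕ) :
    aForm φ lam u (x • φ k) = lam k * ⟪u, φ k⟫ * x := by
  unfold aForm aPow
  rw [tsum_eq_single k]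
  · simp [inner_smul_left, hφ.1 k]
  · intro b hb
    simp [inner_smul_left, hφ.2 hb.symm]

theorem aForm_zero_right {H : Type*} [NormedAddCommGroup H] [InnerProductSpace ℝ H]
    (φ : ℕ → H) (lam : ℕ → ℝ) (u : H) : aForm φ lam u 0 = 0 := by
  simp [aForm, aPow]

/-- The test function equal to the `φ k`-component of `c` on the `m`-th subinterval and to zero
elsewhere. -/
def modeTest {H : Type*} [NormedAddCommGroup H] [InnerProductSpace ℝ H]
    (φ : ℕ → H) (k m : ℕ) (c : ℕ → ℕ → H) (n j : ℕ) : H :=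
  if n = m then ⟪c n j, φ k⟫ • φ k else 0

theorem memHs_modeTest {H : Type*} [NormedAddCommGroup H] [InnerProductSpace ℝ H]
    {φ : ℕ → H} (hφ : Orthonormal ℝ φ) (lam : ℕ → ℝ) (α : ℝ) (k m : ℕ) (c : ℕ → ℕ → H)
    (n j : ℕ) : MemHs φ lam α (modeTest φ k m c n j) := by
  unfold modeTest
  split_ifs
  · exact memHs_smul_basis hφ lam α _ k
  · exact memHs_zero φ lam α

theorem pval_modeTest_self {H : Type*} [NormedAddCommGroup H] [InnerProductSpace ℝ H]
    (φ : ℕ → H) (q k m : ℕ) (c : ℕ → ℕ → H) (s : ℝ) :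
    pval q (modeTest φ k m c) m s = ⟪pval q c m s, φ k⟫ • φ k := by
  simp [pval, modeTest, sum_inner, inner_smul_left, Finset.sum_smul, smul_smul]

theorem pval_modeTest_of_ne {H : Type*} [NormedAddCommGroup H] [InnerProductSpace ℝ H]
    (φ : ℕ → H) (q k : ℕ) {m n : ℕ} (hn : n ≠ m) (c : ℕ → ℕ → H) (s : ℝ) :
    pval q (modeTest φ k m c) n s = 0 := by
  simp [pval, modeTest, hn]

theorem hasDerivAt_inner_pval {H : Type*} [NormedAddCommGroup H] [InnerProductSpace ℝ H]
    (v : H) (q n : ℕ) (c : ℕ → ℕ → H) (s : ℝ) :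
    HasDerivAt (fun t => ⟪pval q c n t, v⟫) ⟪pderiv q c n s, v⟫ s := by
  simp only [pval, pderiv, sum_inner, inner_smul_left]
  refine HasDerivAt.fun_sum fun j _ => ?_
  simpa using (hasDerivAt_pow j s).mul_const ⟪c n j, v⟫

theorem continuous_inner_pval {H : Type*} [NormedAddCommGroup H] [InnerProductSpace ℝ H]
    (v : H) (q n : ℕ) (c : ℕ → ℕ → H) : Continuous fun t => ⟪pval q c n t, v⟫ := by
  unfold pval
  fun_prop

theorem continuous_inner_pderiv {H : Type*} [NormedAddCommGroup H] [InnerProductSpace ℝ H]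
    (v : H) (q n : ℕ) (c : ℕ → ℕ → H) : Continuous fun t => ⟪pderiv q c n t, v⟫ := by
  unfold pderiv
  fun_prop

/-- The left limit at the node `tt m`, with the convention that it vanishes at the initial node. -/
def leftVal {H : Type*} [NormedAddCommGroup H] [InnerProductSpace ℝ H]
    (tt : ℕ → ℝ) (q : ℕ) (c : ℕ → ℕ → H) (m : ℕ) : H :=
  if m = 0 then 0 else pval q c m (tt m)

/-- The bilinear form tested with a single spectral component on a single subinterval. -/
theorem Bform_modeTest {H : Type*} [NormedAddCommGroup H] [InnerProductSpace ℝ H]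
    {φ : ℕ → H} (hφ : Orthonormal ℝ φ) (lam : ℕ → ℝ) (tt : ℕ → ℝ) {N m : ℕ} (hm : m < N)
    (q k : ℕ) (c1 c2 : ℕ → ℕ → H) :
    2 * Bform φ lam tt N q c1 c2 (modeTest φ k (m + 1) c1) (modeTest φ k (m + 1) c2) =
      lam k * ⟪pval q c1 (m + 1) (tt (m + 1)), φ k⟫ ^ 2
        + ⟪pval q c2 (m + 1) (tt (m + 1)), φ k⟫ ^ 2
        + (lam k * ⟪pval q c1 (m + 1) (tt m) - leftVal tt q c1 m, φ k⟫ ^ 2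
          + ⟪pval q c2 (m + 1) (tt m) - leftVal tt q c2 m, φ k⟫ ^ 2)
        - (lam k * ⟪leftVal tt q c1 m, φ k⟫ ^ 2 + ⟪leftVal tt q c2 m, φ k⟫ ^ 2) := by
  have hint : (∑ n ∈ Finset.Icc 1 N, ∫ s in tt (n-1)..tt n,
      (aForm φ lam (pderiv q c1 n s) (pval q (modeTest φ k (m + 1) c1) n s)
        - aForm φ lam (pval q c2 n s) (pval q (modeTest φ k (m + 1) c1) n s)
        + ⟪pderiv q c2 n s, pval q (modeTest φ k (m + 1) c2) n s⟫
        + aForm φ lam (pval q c1 n s) (pval q (modeTest φ k (m + 1) c2) n s))) =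
      (lam k * ⟪pval q c1 (m + 1) (tt (m + 1)), φ k⟫ ^ 2
        + ⟪pval q c2 (m + 1) (tt (m + 1)), φ k⟫ ^ 2) / 2
      - (lam k * ⟪pval q c1 (m + 1) (tt m), φ k⟫ ^ 2
        + ⟪pval q c2 (m + 1) (tt m), φ k⟫ ^ 2) / 2 := by
    rw [Finset.sum_eq_single (m + 1)]
    · simp only [pval_modeTest_self, aForm_smul_basis hφ, inner_smul_right, Nat.add_sub_cancel]
      refine intervalIntegral.integral_eq_sub_of_hasDerivAt
        (f := fun s => (lam k * ⟪pval q c1 (m + 1) s, φ k⟫ ^ 2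
          + ⟪pval q c2 (m + 1) s, φ k⟫ ^ 2) / 2) (fun s _ => ?_) ?_
      · have h1 := ((hasDerivAt_inner_pval (φ k) q (m + 1) c1 s).pow 2).const_mul (lam k)
        have h2 := (hasDerivAt_inner_pval (φ k) q (m + 1) c2 s).pow 2
        refine ((h1.add h2).div_const 2).congr_deriv ?_
        push_cast
        ring
      · have h1 := continuous_inner_pval (φ k) q (m + 1) c1
        have h2 := continuous_inner_pval (φ k) q (m + 1) c2
        have h3 := continuous_inner_pderiv (φ k) q (m + 1) c1
        have h4 := continuous_inner_pderiv (φ k) q (m + 1) c2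
        apply Continuous.intervalIntegrable
        fun_prop
    · intro n _ hn
      simp [pval_modeTest_of_ne φ q k hn, aForm_zero_right]
    · intro h
      exact absurd (Finset.mem_Icc.2 ⟨by omega, by omega⟩) h
  unfold Bform
  rw [hint]
  rcases Nat.eq_zero_or_pos m with rfl | hpos
  · rw [Finset.sum_eq_zero]
    · simp [pval_modeTest_self, aForm_smul_basis hφ, inner_smul_right, leftVal]
      ring
    · intro n hn
      have hn' : n + 1 ≠ 0 + 1 := by
        have := (Finset.mem_Icc.1 hn).1
        omega
      simp [pval_modeTest_of_ne φ q k hn', aForm_zero_right]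
  · have hm1 : (1 : ℕ) ≠ m + 1 := by omega
    rw [Finset.sum_eq_single m]
    · simp only [pval_modeTest_self, pval_modeTest_of_ne φ q k hm1, aForm_zero_right,
        aForm_smul_basis hφ, inner_smul_right, leftVal, hpos.ne', if_false, inner_sub_left,
        inner_zero_right]
      ring
    · intro n _ hn
      have hn' : n + 1 ≠ m + 1 := by omega
      simp [pval_modeTest_of_ne φ q k hn', aForm_zero_right]
    · intro h
      exact absurd (Finset.mem_Icc.2 ⟨by omega, by omega⟩) h

/-- Energy estimate for jump recursions: if the energy balance on each step is controlled by
`2 * M * I i`, where `M` bounds both one-sided values on the step, then all these values are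
bounded by `8 * ∑ I i`. -/
theorem jump_recursion_bound {E : Type*} [NormedAddCommGroup E] {N : ℕ} (hN : 1 ≤ N)
    (p r : ℕ → E) (I : ℕ → ℝ) (hp0 : p 0 = 0) (hI : ∀ i < N, 0 ≤ I i)
    (hstep : ∀ i < N, ∀ M, ‖p (i + 1)‖ ≤ M → ‖r i‖ ≤ M →
      ‖p (i + 1)‖ ^ 2 + ‖r i - p i‖ ^ 2 - ‖p i‖ ^ 2 ≤ 2 * M * I i) :
    ∀ i < N, ‖p (i + 1)‖ ≤ 8 * ∑ j ∈ Finset.range N, I j ∧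
      ‖r i‖ ≤ 8 * ∑ j ∈ Finset.range N, I j := by
  obtain ⟨i₀, hi₀, hmax⟩ := Finset.exists_max_image (Finset.range N)
    (fun i => max ‖p (i + 1)‖ ‖r i‖) ⟨0, Finset.mem_range.2 (by omega)⟩
  set M := max ‖p (i₀ + 1)‖ ‖r i₀‖ with hM
  set S := ∑ j ∈ Finset.range N, I j with hS
  have hM0 : 0 ≤ M := (norm_nonneg _).trans (le_max_left _ _)
  have hle : ∀ i < N, ‖p (i + 1)‖ ≤ M ∧ ‖r i‖ ≤ M := fun i hi =>
    max_le_iff.1 (hmax i (Finset.mem_range.2 hi))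
  have hpart : ∀ n ≤ N, ∑ j ∈ Finset.range n, I j ≤ S := fun n hn =>
    Finset.sum_le_sum_of_subset_of_nonneg (Finset.range_mono hn)
      fun i hi _ => hI i (Finset.mem_range.1 hi)
  have hp : ∀ n ≤ N, ‖p n‖ ^ 2 ≤ 2 * M * ∑ j ∈ Finset.range n, I j := by
    intro n
    induction n with
    | zero => intro _; simp [hp0]
    | succ n ih =>
      intro hn
      have h1 := ih (by omega)
      have h2 := hstep n (by omega) M (hle n (by omega)).1 (hle n (by omega)).2
      rw [Finset.sum_range_succ]
      nlinarith [sq_nonneg ‖r n - p n‖]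
  have hpS : ∀ n ≤ N, ‖p n‖ ^ 2 ≤ 2 * M * S := fun n hn =>
    (hp n hn).trans (by gcongr; exact hpart n hn)
  have hrS : ∀ i < N, ‖r i‖ ^ 2 ≤ 8 * (M * S) := by
    intro i hi
    have h1 := hstep i hi M (hle i hi).1 (hle i hi).2
    have h2 := hp i hi.le
    have h3 : M * ∑ j ∈ Finset.range (i + 1), I j ≤ M * S :=
      mul_le_mul_of_nonneg_left (hpart (i + 1) hi) hM0
    rw [Finset.sum_range_succ] at h3
    have h4 : ‖r i‖ ≤ ‖r i - p i‖ + ‖p i‖ := by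
      simpa using norm_add_le (r i - p i) (p i)
    have h5 : ‖r i‖ ^ 2 ≤ (‖r i - p i‖ + ‖p i‖) ^ 2 := by gcongr
    have h6 := hpS i hi.le
    nlinarith [sq_nonneg (‖r i - p i‖ - ‖p i‖), sq_nonneg ‖p (i + 1)‖]
  have hS0 : 0 ≤ S := Finset.sum_nonneg fun i hi => hI i (Finset.mem_range.1 hi)
  have hMM : M ^ 2 ≤ 8 * (M * S) := by
    rcases max_choice ‖p (i₀ + 1)‖ ‖r i₀‖ with h | h
    · have := hpS (i₀ + 1) (Finset.mem_range.1 hi₀)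
      rw [← h, ← hM] at this
      nlinarith [mul_nonneg hM0 hS0]
    · have := hrS i₀ (Finset.mem_range.1 hi₀)
      rwa [← h, ← hM] at this
  have hMS : M ≤ 8 * S := by
    rcases hM0.eq_or_lt with h | h
    · rw [← h]; positivity
    · nlinarith
  exact fun i hi => ⟨(hle i hi).1.trans hMS, (hle i hi).2.trans hMS⟩

/-- The complex number encoding the `φ k`-components of a pair, scaled so that its modulus is the
energy norm of these components. -/
def modeVal {H : Type*} [NormedAddCommGroup H] [InnerProductSpace ℝ H]
    (φ : ℕ → H) (lam : ℕ → ℝ) (k : ℕ) (u v : H) : ℂ :=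
  ⟨√(lam k) * ⟪u, φ k⟫, ⟪v, φ k⟫⟩

theorem norm_modeVal_sq {H : Type*} [NormedAddCommGroup H] [InnerProductSpace ℝ H]
    (φ : ℕ → H) {lam : ℕ → ℝ} {k : ℕ} (hk : 0 ≤ lam k) (u v : H) :
    ‖modeVal φ lam k u v‖ ^ 2 = lam k * ⟪u, φ k⟫ ^ 2 + ⟪v, φ k⟫ ^ 2 := by
  rw [← Complex.normSq_eq_norm_sq, Complex.normSq_apply]
  simp only [modeVal]
  nlinarith [Real.mul_self_sqrt hk]

theorem modeVal_sub {H : Type*} [NormedAddCommGroup H] [InnerProductSpace ℝ H]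
    (φ : ℕ → H) (lam : ℕ → ℝ) (k : ℕ) (u v u' v' : H) :
    modeVal φ lam k u v - modeVal φ lam k u' v' = modeVal φ lam k (u - u') (v - v') := by
  apply Complex.ext <;> simp [modeVal, inner_sub_left, mul_sub]

/-- For degree at most one, the values inside a subinterval are bounded by those at its ends. -/
theorem norm_modeVal_pval_le {H : Type*} [NormedAddCommGroup H] [InnerProductSpace ℝ H]
    (φ : ℕ → H) (lam : ℕ → ℝ) (k : ℕ) {q : ℕ} (hq : q = 0 ∨ q = 1) (c1 c2 : ℕ → ℕ → H) (n : ℕ)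
    {a b s M : ℝ} (hs : s ∈ Set.Icc a b)
    (ha : ‖modeVal φ lam k (pval q c1 n a) (pval q c2 n a)‖ ≤ M)
    (hb : ‖modeVal φ lam k (pval q c1 n b) (pval q c2 n b)‖ ≤ M) :
    ‖modeVal φ lam k (pval q c1 n s) (pval q c2 n s)‖ ≤ M := by
  have hab : a ≤ b := hs.1.trans hs.2
  rw [← segment_eq_Icc hab] at hs
  obtain ⟨x, y, hx, hy, hxy, rfl⟩ := hs
  have key : modeVal φ lam k (pval q c1 n (x • a + y • b)) (pval q c2 n (x • a + y • b)) =
      x • modeVal φ lam k (pval q c1 n a) (pval q c2 n a)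
        + y • modeVal φ lam k (pval q c1 n b) (pval q c2 n b) := by
    obtain rfl : x = 1 - y := by linarith
    rcases hq with rfl | rfl <;>
      apply Complex.ext <;>
      simp [modeVal, pval, Finset.sum_range_succ, inner_add_left, inner_smul_left] <;> ring
  rw [key]
  have := convex_closedBall (0 : ℂ) M (mem_closedBall_zero_iff.2 ha)
    (mem_closedBall_zero_iff.2 hb) hx hy hxy
  exact mem_closedBall_zero_iff.1 this

/-- Finite sums of squared weighted spectral coefficients are bounded by the fractional-order norm. -/
theorem sum_le_hsNorm_sq {H : Type*} [NormedAddCommGroup H] [InnerProductSpace ℝ H]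
    {φ : ℕ → H} {lam : ℕ → ℝ} (hlam : ∀ k, 0 < lam k) {α : ℝ} {v : H}
    (hv : MemHs φ lam α v) (s : Finset ℕ) :
    ∑ k ∈ s, lam k ^ α * ⟪v, φ k⟫ ^ 2 ≤ hsNorm φ lam α v ^ 2 := by
  have h0 : ∀ k, 0 ≤ lam k ^ α * ⟪v, φ k⟫ ^ 2 := fun k =>
    mul_nonneg (Real.rpow_nonneg (hlam k).le _) (sq_nonneg _)
  rw [hsNorm, hsNormSq, Real.sq_sqrt (tsum_nonneg h0)]
  exact hv.sum_le_tsum s fun k _ => h0 k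

theorem intervalIntegrable_inner_of_hsNorm {H : Type*} [NormedAddCommGroup H]
    [InnerProductSpace ℝ H] {φ : ℕ → H} {lam : ℕ → ℝ} (hlam : ∀ k, 0 < lam k) {α : ℝ}
    {f : ℝ → H} (hf : AEStronglyMeasurable f volume) (hfm : ∀ t, MemHs φ lam α (f t))
    {a b : ℝ} (hfi : IntervalIntegrable (fun t => hsNorm φ lam α (f t)) volume a b) (k : ℕ) :
    IntervalIntegrable (fun t => ⟪f t, φ k⟫) volume a b := by
  have hw : 0 < lam k ^ α := Real.rpow_pos_of_pos (hlam k) _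
  refine (hfi.const_mul (√(lam k ^ α))⁻¹).mono_fun
    (hf.inner aestronglyMeasurable_const).restrict (Filter.Eventually.of_forall fun t => ?_)
  have h := sum_le_hsNorm_sq hlam (hfm t) {k}
  rw [Finset.sum_singleton, ← Real.sq_sqrt hw.le, ← mul_pow] at h
  have h' := abs_le_of_sq_le_sq' h (Real.sqrt_nonneg _)
  have hs : 0 < √(lam k ^ α) := Real.sqrt_pos.2 hw
  have h2 : √(lam k ^ α) * |⟪f t, φ k⟫| ≤ hsNorm φ lam α (f t) := by
    rw [← abs_of_pos hs, ← abs_mul]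
    exact abs_le.2 (by simpa [abs_of_pos hs] using h')
  simp only [Real.norm_eq_abs]
  refine le_trans ?_ (le_abs_self _)
  rw [inv_mul_eq_div, le_div_iff₀ hs]
  linarith

/-- Minkowski's integral inequality for finitely many weighted coefficients. -/
theorem sum_integral_sq_le {a b : ℝ} (hab : a ≤ b) (s : Finset ℕ) (g : ℕ → ℝ → ℝ)
    (hg : ∀ k, IntervalIntegrable (g k) volume a b) (G : ℝ → ℝ)
    (hG : IntervalIntegrable G volume a b) (hG0 : ∀ t, 0 ≤ G t)
    (hle : ∀ t, ∑ k ∈ s, g k t ^ 2 ≤ G t ^ 2) :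
    ∑ k ∈ s, (∫ t in a..b, g k t) ^ 2 ≤ (∫ t in a..b, G t) ^ 2 := by
  let F : ℝ → EuclideanSpace ℝ s := fun t => WithLp.toLp 2 fun k => g k t
  have hnorm : ∀ t, ‖F t‖ ≤ G t := fun t => by
    refine abs_le_of_sq_le_sq' ?_ (hG0 t) |>.2
    rw [EuclideanSpace.norm_sq_eq]
    simpa [F, Finset.sum_attach s fun k => g k t ^ 2] using hle t
  have hFi : Integrable F (volume.restrict (Set.Ioc a b)) :=
    Integrable.of_eval_piLp fun k => (intervalIntegrable_iff_integrableOn_Ioc_of_le hab).1 (hg k)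
  have hcoord : ∀ k : s, (∫ t in a..b, F t) k = ∫ t in a..b, g k t := fun k => by
    rw [intervalIntegral.integral_of_le hab, intervalIntegral.integral_of_le hab]
    exact ((EuclideanSpace.proj k : EuclideanSpace ℝ s →L[ℝ] ℝ).integral_comp_comm hFi).symm
  have h1 : ‖∫ t in a..b, F t‖ ≤ ∫ t in a..b, G t :=
    intervalIntegral.norm_integral_le_of_norm_le hab
      (Filter.Eventually.of_forall fun t _ => hnorm t) hG
  have h2 : ‖∫ t in a..b, F t‖ ^ 2 ≤ (∫ t in a..b, G t) ^ 2 := by gcongr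
  rw [EuclideanSpace.norm_sq_eq] at h2
  simpa [hcoord, Finset.sum_attach s fun k => (∫ t in a..b, g k t) ^ 2] using h2

/-- Stability of a single spectral component, in the energy norm. -/
theorem mode_stability {H : Type*} [NormedAddCommGroup H] [InnerProductSpace ℝ H]
    {φ : ℕ → H} {lam : ℕ → ℝ} (hφ : Orthonormal ℝ φ) (hlam : ∀ k, 0 < lam k)
    {q : ℕ} (hq : q = 0 ∨ q = 1) {N : ℕ} (hN : 1 ≤ N) {tt : ℕ → ℝ}
    (htt : ∀ n < N, tt n < tt (n + 1)) {f1 f2 : ℝ → H} {k : ℕ}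
    (hf1 : ∀ n < N, IntervalIntegrable (fun t => ⟪f1 t, φ k⟫) volume (tt n) (tt (n + 1)))
    (hf2 : ∀ n < N, IntervalIntegrable (fun t => ⟪f2 t, φ k⟫) volume (tt n) (tt (n + 1)))
    {c1 c2 : ℕ → ℕ → H}
    (hU : ∀ d1 d2 : ℕ → ℕ → H, (∀ n j, MemHs φ lam 1 (d1 n j)) →
        (∀ n j, MemHs φ lam 1 (d2 n j)) →
        Bform φ lam tt N q c1 c2 d1 d2 =
          ∑ n ∈ Finset.Icc 1 N, ∫ s in tt (n-1)..tt n,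
            (aForm φ lam (f1 s) (pval q d1 n s) + ⟪f2 s, pval q d2 n s⟫))
    {n : ℕ} (hn : n < N) {t : ℝ} (ht : t ∈ Set.Icc (tt n) (tt (n + 1))) :
    ‖modeVal φ lam k (pval q c1 (n + 1) t) (pval q c2 (n + 1) t)‖ ≤
      8 * ∫ s in tt 0..tt N, (√(lam k) * |⟪f1 s, φ k⟫| + |⟪f2 s, φ k⟫|) := by
  have hg : ∀ i < N, IntervalIntegrable
      (fun s => √(lam k) * |⟪f1 s, φ k⟫| + |⟪f2 s, φ k⟫|) volume (tt i) (tt (i + 1)) :=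
    fun i hi => ((hf1 i hi).abs.const_mul _).add (hf2 i hi).abs
  have hstep : ∀ i < N, ∀ M,
      ‖modeVal φ lam k (leftVal tt q c1 (i + 1)) (leftVal tt q c2 (i + 1))‖ ≤ M →
      ‖modeVal φ lam k (pval q c1 (i + 1) (tt i)) (pval q c2 (i + 1) (tt i))‖ ≤ M →
      ‖modeVal φ lam k (leftVal tt q c1 (i + 1)) (leftVal tt q c2 (i + 1))‖ ^ 2
        + ‖modeVal φ lam k (pval q c1 (i + 1) (tt i)) (pval q c2 (i + 1) (tt i))
          - modeVal φ lam k (leftVal tt q c1 i) (leftVal tt q c2 i)‖ ^ 2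
        - ‖modeVal φ lam k (leftVal tt q c1 i) (leftVal tt q c2 i)‖ ^ 2
      ≤ 2 * M * ∫ s in tt i..tt (i + 1), (√(lam k) * |⟪f1 s, φ k⟫| + |⟪f2 s, φ k⟫|) := by
    intro i hi M hp hr
    have hB := Bform_modeTest hφ lam tt hi q k c1 c2
    rw [hU _ _ (memHs_modeTest hφ lam 1 k _ c1) (memHs_modeTest hφ lam 1 k _ c2),
      Finset.sum_eq_single (i + 1)] at hB
    rotate_left
    · intro n _ hn
      simp [pval_modeTest_of_ne φ q k hn, aForm_zero_right]
    · intro h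
      exact absurd (Finset.mem_Icc.2 ⟨by omega, by omega⟩) h
    simp only [pval_modeTest_self, aForm_smul_basis hφ, inner_smul_right,
      Nat.add_sub_cancel] at hB
    simp only [leftVal, Nat.succ_ne_zero, if_false] at hp ⊢
    simp only [leftVal] at hB
    rw [modeVal_sub, norm_modeVal_sq φ (hlam k).le, norm_modeVal_sq φ (hlam k).le,
      norm_modeVal_sq φ (hlam k).le, ← hB, mul_assoc, ← intervalIntegral.integral_const_mul M]
    refine mul_le_mul_of_nonneg_left (intervalIntegral.integral_mono_on (htt i hi).le ?_
      ((hg i hi).const_mul M) fun s hs => ?_) two_pos.le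
    · exact (((hf1 i hi).const_mul _).mul_continuousOn
        (continuous_inner_pval (φ k) q (i + 1) c1).continuousOn).add
        ((hf2 i hi).continuousOn_mul (continuous_inner_pval (φ k) q (i + 1) c2).continuousOn)
    · have hZ := norm_modeVal_pval_le φ lam k hq c1 c2 (i + 1) hs hr hp
      have hre := (Complex.abs_re_le_norm _).trans hZ
      have him := (Complex.abs_im_le_norm _).trans hZ
      simp only [modeVal] at hre him
      have hw := Real.mul_self_sqrt (hlam k).le
      have hw0 := Real.sqrt_nonneg (lam k)
      generalize √(lam k) = w at *
      calc lam k * ⟪f1 s, φ k⟫ * ⟪pval q c1 (i + 1) s, φ k⟫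
            + ⟪pval q c2 (i + 1) s, φ k⟫ * ⟪f2 s, φ k⟫
          = (w * ⟪f1 s, φ k⟫) * (w * ⟪pval q c1 (i + 1) s, φ k⟫)
            + ⟪f2 s, φ k⟫ * ⟪pval q c2 (i + 1) s, φ k⟫ := by rw [← hw]; ring
        _ ≤ |w * ⟪f1 s, φ k⟫| * |w * ⟪pval q c1 (i + 1) s, φ k⟫|
            + |⟪f2 s, φ k⟫| * |⟪pval q c2 (i + 1) s, φ k⟫| := by
          rw [← abs_mul, ← abs_mul]
          exact add_le_add (le_abs_self _) (le_abs_self _)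
        _ ≤ |w * ⟪f1 s, φ k⟫| * M + |⟪f2 s, φ k⟫| * M := by gcongr
        _ = M * (w * |⟪f1 s, φ k⟫| + |⟪f2 s, φ k⟫|) := by
          rw [abs_mul, abs_of_nonneg hw0]; ring
  have hbound := jump_recursion_bound hN
    (fun i => modeVal φ lam k (leftVal tt q c1 i) (leftVal tt q c2 i))
    (fun i => modeVal φ lam k (pval q c1 (i + 1) (tt i)) (pval q c2 (i + 1) (tt i)))
    (fun i => ∫ s in tt i..tt (i + 1), (√(lam k) * |⟪f1 s, φ k⟫| + |⟪f2 s, φ k⟫|))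
    (by apply Complex.ext <;> simp [modeVal, leftVal])
    (fun i hi => intervalIntegral.integral_nonneg (htt i hi).le fun s _ => by positivity)
    hstep n hn
  rw [intervalIntegral.sum_integral_adjacent_intervals hg] at hbound
  refine norm_modeVal_pval_le φ lam k hq c1 c2 (n + 1) ht hbound.2 ?_
  simpa [leftVal] using hbound.1

/-- Fractional-order norms are controlled by integrals of weighted spectral coefficients. -/
theorem hsNorm_le_integral {H : Type*} [NormedAddCommGroup H] [InnerProductSpace ℝ H]
    {φ : ℕ → H} {lam : ℕ → ℝ} (hlam : ∀ k, 0 < lam k) {l T : ℝ} (hT : 0 ≤ T) {f1 f2 : ℝ → H}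
    (hf1 : AEStronglyMeasurable f1 volume) (hf2 : AEStronglyMeasurable f2 volume)
    (hm1 : ∀ t, MemHs φ lam (l+1) (f1 t)) (hm2 : ∀ t, MemHs φ lam l (f2 t))
    (hi1 : IntervalIntegrable (fun t => hsNorm φ lam (l+1) (f1 t)) volume 0 T)
    (hi2 : IntervalIntegrable (fun t => hsNorm φ lam l (f2 t)) volume 0 T)
    {α K : ℝ} (hK : 0 ≤ K) {u : H}
    (hu : ∀ k, lam k ^ α * ⟪u, φ k⟫ ^ 2 ≤
      lam k ^ l * (K * ∫ s in (0 : ℝ)..T, (√(lam k) * |⟪f1 s, φ k⟫| + |⟪f2 s, φ k⟫|)) ^ 2) :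
    hsNorm φ lam α u ≤
      K * ∫ t in (0:ℝ)..T, (hsNorm φ lam (l+1) (f1 t) + hsNorm φ lam l (f2 t)) := by
  have hn0 : ∀ (α : ℝ) (v : H), 0 ≤ hsNorm φ lam α v := fun _ _ => Real.sqrt_nonneg _
  have hI0 : 0 ≤ ∫ t in (0:ℝ)..T, (hsNorm φ lam (l+1) (f1 t) + hsNorm φ lam l (f2 t)) :=
    intervalIntegral.integral_nonneg hT fun t _ => add_nonneg (hn0 _ _) (hn0 _ _)
  have hg1 := intervalIntegrable_inner_of_hsNorm hlam hf1 hm1 hi1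
  have hg2 := intervalIntegrable_inner_of_hsNorm hlam hf2 hm2 hi2
  refine Real.sqrt_le_iff.2 ⟨mul_nonneg hK hI0, Real.tsum_le_of_sum_le (fun k =>
    mul_nonneg (Real.rpow_nonneg (hlam k).le _) (sq_nonneg _)) fun s => ?_⟩
  have hmink := sum_integral_sq_le hT s
    (fun k t => √(lam k ^ l) * (√(lam k) * |⟪f1 t, φ k⟫| + |⟪f2 t, φ k⟫|))
    (fun k => (((hg1 k).abs.const_mul _).add (hg2 k).abs).const_mul _) _ (hi1.add hi2)
    (fun t => add_nonneg (hn0 _ _) (hn0 _ _)) fun t => by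
      have h1 := sum_le_hsNorm_sq hlam (hm1 t) s
      have h2 := sum_le_hsNorm_sq hlam (hm2 t) s
      have hpow : ∀ k, lam k ^ (l + 1) = lam k ^ l * lam k := fun k => by
        rw [Real.rpow_add (hlam k), Real.rpow_one]
      have e1 : ∑ k ∈ s, (√(lam k ^ l) * (√(lam k) * |⟪f1 t, φ k⟫|)) ^ 2
          = ∑ k ∈ s, lam k ^ (l + 1) * ⟪f1 t, φ k⟫ ^ 2 := Finset.sum_congr rfl fun k _ => by
        rw [mul_pow, mul_pow, Real.sq_sqrt (Real.rpow_nonneg (hlam k).le _),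
          Real.sq_sqrt (hlam k).le, sq_abs, hpow]
        ring
      have e2 : ∑ k ∈ s, (√(lam k ^ l) * |⟪f2 t, φ k⟫|) ^ 2
          = ∑ k ∈ s, lam k ^ l * ⟪f2 t, φ k⟫ ^ 2 := Finset.sum_congr rfl fun k _ => by
        rw [mul_pow, Real.sq_sqrt (Real.rpow_nonneg (hlam k).le _), sq_abs]
      rw [← e1] at h1
      rw [← e2] at h2
      have hcs : ∑ k ∈ s, (√(lam k ^ l) * (√(lam k) * |⟪f1 t, φ k⟫|)) *
          (√(lam k ^ l) * |⟪f2 t, φ k⟫|) ≤ hsNorm φ lam (l+1) (f1 t) * hsNorm φ lam l (f2 t) := by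
        refine abs_le_of_sq_le_sq' ?_ (mul_nonneg (hn0 _ _) (hn0 _ _)) |>.2
        refine (Finset.sum_mul_sq_le_sq_mul_sq s _ _).trans ?_
        rw [mul_pow]
        exact mul_le_mul h1 h2 (Finset.sum_nonneg fun _ _ => sq_nonneg _) (sq_nonneg _)
      calc _ = ∑ k ∈ s, (√(lam k ^ l) * (√(lam k) * |⟪f1 t, φ k⟫|)) ^ 2
            + 2 * ∑ k ∈ s, (√(lam k ^ l) * (√(lam k) * |⟪f1 t, φ k⟫|)) *
              (√(lam k ^ l) * |⟪f2 t, φ k⟫|)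
            + ∑ k ∈ s, (√(lam k ^ l) * |⟪f2 t, φ k⟫|) ^ 2 := by
            rw [Finset.mul_sum, ← Finset.sum_add_distrib, ← Finset.sum_add_distrib]
            exact Finset.sum_congr rfl fun k _ => by ring
        _ ≤ (hsNorm φ lam (l+1) (f1 t) + hsNorm φ lam l (f2 t)) ^ 2 := by linarith
  calc ∑ k ∈ s, lam k ^ α * ⟪u, φ k⟫ ^ 2
      ≤ ∑ k ∈ s, K ^ 2 * (∫ t in (0:ℝ)..T,
        √(lam k ^ l) * (√(lam k) * |⟪f1 t, φ k⟫| + |⟪f2 t, φ k⟫|)) ^ 2 := by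
        refine Finset.sum_le_sum fun k _ => (hu k).trans_eq ?_
        rw [intervalIntegral.integral_const_mul, mul_pow, mul_pow,
          Real.sq_sqrt (Real.rpow_nonneg (hlam k).le _)]
        ring
    _ ≤ (K * ∫ t in (0:ℝ)..T, (hsNorm φ lam (l+1) (f1 t) + hsNorm φ lam l (f2 t))) ^ 2 := by
        rw [← Finset.mul_sum, mul_pow]
        exact mul_le_mul_of_nonneg_left hmink (sq_nonneg K)

/-- **Inequality (4.10): uniform-in-time stability of dG(0) and dG(1) with vanishing
initial data.**
`sup_{(0,T)} ‖U₁‖_{l+1} + sup_{(0,T)} ‖U₂‖_l ≤ C ∫₀ᵀ (‖f₁‖_{l+1} + ‖f₂‖_l)`. -/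
theorem dG_uniform_stability
    {H : Type*} [NormedAddCommGroup H] [InnerProductSpace ℝ H] [CompleteSpace H]
    (φ : ℕ → H) (lam : ℕ → ℝ)
    (hφ : Orthonormal ℝ φ)
    (hφtotal : (Submodule.span ℝ (Set.range φ)).topologicalClosure = ⊤)
    (hlam_pos : ∀ k, 0 < lam k) (hlam_mono : Monotone lam)
    (hlam_top : Filter.Tendsto lam Filter.atTop Filter.atTop)
    (q : ℕ) (hq : q = 0 ∨ q = 1) (l : ℝ) :
    ∃ C : ℝ, 0 < C ∧
      ∀ (T : ℝ), 0 < T → ∀ (N : ℕ), 1 ≤ N →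
      ∀ tt : ℕ → ℝ, tt 0 = 0 → tt N = T → (∀ n < N, tt n < tt (n + 1)) →
      -- data
      ∀ f1 f2 : ℝ → H,
      AEStronglyMeasurable f1 volume → AEStronglyMeasurable f2 volume →
      (∀ t, MemHs φ lam (l+1) (f1 t)) → (∀ t, MemHs φ lam l (f2 t)) →
      IntervalIntegrable (fun t => hsNorm φ lam (l+1) (f1 t)) volume 0 T →
      IntervalIntegrable (fun t => hsNorm φ lam l (f2 t)) volume 0 T →
      -- U = (U₁,U₂) ∈ 𝒱_q, with U₁(t) ∈ Ḣ^{l+1} and U₂(t) ∈ Ḣ^l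
      ∀ c1 c2 : ℕ → ℕ → H,
      (∀ n j, MemHs φ lam 1 (c1 n j)) → (∀ n j, MemHs φ lam 1 (c2 n j)) →
      (∀ n j, MemHs φ lam (l+1) (c1 n j)) → (∀ n j, MemHs φ lam l (c2 n j)) →
      -- the generalized discrete problem with u₀ = 0 and v₀ = 0
      (∀ d1 d2 : ℕ → ℕ → H, (∀ n j, MemHs φ lam 1 (d1 n j)) →
        (∀ n j, MemHs φ lam 1 (d2 n j)) →
        Bform φ lam tt N q c1 c2 d1 d2 =
          ∑ n ∈ Finset.Icc 1 N, ∫ s in tt (n-1)..tt n,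
            (aForm φ lam (f1 s) (pval q d1 n s) + ⟪f2 s, pval q d2 n s⟫)) →
      -- U₁, U₂ as functions of time (left-continuous piecewise polynomials)
      ∀ U1f U2f : ℝ → H,
      (∀ n ∈ Finset.Icc 1 N, ∀ t ∈ Set.Ioc (tt (n-1)) (tt n), U1f t = pval q c1 n t) →
      (∀ n ∈ Finset.Icc 1 N, ∀ t ∈ Set.Ioc (tt (n-1)) (tt n), U2f t = pval q c2 n t) →
      (BddAbove ((fun t => hsNorm φ lam (l+1) (U1f t)) '' Set.Ioo 0 T) ∧
       BddAbove ((fun t => hsNorm φ lam l (U2f t)) '' Set.Ioo 0 T) ∧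
       supIoo (fun t => hsNorm φ lam (l+1) (U1f t)) 0 T
          + supIoo (fun t => hsNorm φ lam l (U2f t)) 0 T
        ≤ C * ∫ t in (0:ℝ)..T,
            (hsNorm φ lam (l+1) (f1 t) + hsNorm φ lam l (f2 t))) := by
  refine ⟨16, by norm_num, ?_⟩
  intro T hT N hN tt h0 hNT htt f1 f2 hf1 hf2 hm1 hm2 hi1 hi2 c1 c2 _ _ _ _ hU U1f U2f hU1 hU2
  have hmono : ∀ i j, i ≤ j → j ≤ N → tt i ≤ tt j := by
    intro i j hij
    induction j, hij using Nat.le_induction with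
    | base => exact fun _ => le_rfl
    | succ j _ ih => exact fun hj => (ih (by omega)).trans (htt j (by omega)).le
  have hsub : ∀ n < N, Set.uIcc (tt n) (tt (n + 1)) ⊆ Set.uIcc 0 T := fun n hn => by
    rw [Set.uIcc_of_le (htt n hn).le, Set.uIcc_of_le hT.le, ← h0, ← hNT]
    exact Set.Icc_subset_Icc (hmono 0 n (by omega) hn.le) (hmono (n + 1) N (by omega) le_rfl)
  have hmode : ∀ k, ∀ t ∈ Set.Ioo 0 T, ‖modeVal φ lam k (U1f t) (U2f t)‖ ≤
      8 * ∫ s in (0:ℝ)..T, (√(lam k) * |⟪f1 s, φ k⟫| + |⟪f2 s, φ k⟫|) := by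
    intro k t ht
    have hex : ∃ n, t ≤ tt n := ⟨N, hNT ▸ ht.2.le⟩
    classical
    obtain ⟨n, hn⟩ : ∃ n, Nat.find hex = n + 1 := by
      refine Nat.exists_eq_succ_of_ne_zero fun h => ?_
      have := Nat.find_spec hex
      rw [h, h0] at this
      exact absurd ht.1 this.not_gt
    have hle : t ≤ tt (n + 1) := hn ▸ Nat.find_spec hex
    have hlt : tt n < t := not_le.1 (Nat.find_min hex (by omega))
    have hnN : n < N := by
      have := Nat.find_min' hex (hNT ▸ ht.2.le : t ≤ tt N)
      omega
    have hmem : n + 1 ∈ Finset.Icc 1 N := Finset.mem_Icc.2 ⟨by omega, by omega⟩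
    rw [hU1 (n + 1) hmem t ⟨hlt, hle⟩, hU2 (n + 1) hmem t ⟨hlt, hle⟩]
    have := mode_stability (k := k) hφ hlam_pos hq hN htt
      (fun i hi => (intervalIntegrable_inner_of_hsNorm hlam_pos hf1 hm1 hi1 k).mono_set
        (hsub i hi))
      (fun i hi => (intervalIntegrable_inner_of_hsNorm hlam_pos hf2 hm2 hi2 k).mono_set
        (hsub i hi)) hU hnN ⟨hlt.le, hle⟩
    rwa [h0, hNT] at this
  have hb1 : ∀ t ∈ Set.Ioo 0 T, hsNorm φ lam (l+1) (U1f t) ≤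
      8 * ∫ t in (0:ℝ)..T, (hsNorm φ lam (l+1) (f1 t) + hsNorm φ lam l (f2 t)) := fun t ht =>
    hsNorm_le_integral hlam_pos hT.le hf1 hf2 hm1 hm2 hi1 hi2 (by norm_num) fun k => by
      have hsq := pow_le_pow_left₀ (norm_nonneg _) (hmode k t ht) 2
      rw [norm_modeVal_sq φ (hlam_pos k).le] at hsq
      rw [Real.rpow_add (hlam_pos k), Real.rpow_one, mul_assoc]
      exact mul_le_mul_of_nonneg_left (by linarith [sq_nonneg ⟪U2f t, φ k⟫])
        (Real.rpow_nonneg (hlam_pos k).le _)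
  have hb2 : ∀ t ∈ Set.Ioo 0 T, hsNorm φ lam l (U2f t) ≤
      8 * ∫ t in (0:ℝ)..T, (hsNorm φ lam (l+1) (f1 t) + hsNorm φ lam l (f2 t)) := fun t ht =>
    hsNorm_le_integral hlam_pos hT.le hf1 hf2 hm1 hm2 hi1 hi2 (by norm_num) fun k => by
      have hsq := pow_le_pow_left₀ (norm_nonneg _) (hmode k t ht) 2
      rw [norm_modeVal_sq φ (hlam_pos k).le] at hsq
      refine mul_le_mul_of_nonneg_left ?_ (Real.rpow_nonneg (hlam_pos k).le _)
      linarith [mul_nonneg (hlam_pos k).le (sq_nonneg ⟪U1f t, φ k⟫)]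
  have hne : (Set.Ioo 0 T).Nonempty := Set.nonempty_Ioo.2 hT
  refine ⟨⟨_, Set.forall_mem_image.2 hb1⟩, ⟨_, Set.forall_mem_image.2 hb2⟩, ?_⟩
  have hs1 := csSup_le (hne.image _) (Set.forall_mem_image.2 hb1)
  have hs2 := csSup_le (hne.image _) (Set.forall_mem_image.2 hb2)
  unfold supIoo
  linarith
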